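/- In the weighted reduction, if the edge list covers vertices, then for every y ∈ ℤ^n there exists a binary vector b ∈ {0,1}^n with ‖B·b − t‖_p ≤ ‖B·y − t‖_p; in particular, inf_{y ∈ ℤ^n} ‖B·y − t‖_p = min_{b ∈ {0,1}^n} ‖B·b − t‖_p, and this infimum is attained. -/

import Mathlib

open Finset Matrix

/-- The matrix of the weighted Max-Cut-to-CVP reduction, with `ω k = (w k)^(1/p)`.
The ambient dimension `2m` is indexed by `Fin m × Bool`, where `(k, false)` is the
coordinate `2k-1` and `(k, true)` is the coordinate `2k` of the paper. -/
noncomputable def BmatW {n m : ℕ} (p ι : ℝ) (E : Fin m → Fin n × Fin n) (w : Fin m → ℝ) :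
    Matrix (Fin m × Bool) (Fin n) ℝ := fun j i =>
  if j.2 then
    (if i = (E j.1).1 then ι * (w j.1) ^ (1 / p) else 0) +
      (if i = (E j.1).2 then ι * (w j.1) ^ (1 / p) else 0)
  else
    (if i = (E j.1).1 then (-1 : ℝ) else 0) + (if i = (E j.1).2 then 1 else 0)

/-- The target vector of the weighted reduction: `t_{2k-1} = 0`, `t_{2k} = ι·ω k`. -/
noncomputable def tvecW (m : ℕ) (p ι : ℝ) (w : Fin m → ℝ) : Fin m × Bool → ℝ :=
  fun j => if j.2 then ι * (w j.1) ^ (1 / p) else 0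

/-- The `ℓ_p` norm `(∑ j, |x j| ^ p) ^ (1/p)` (real exponents). -/
noncomputable def lpNorm {d : Type*} [Fintype d] (p : ℝ) (x : d → ℝ) : ℝ :=
  (∑ j, |x j| ^ p) ^ (1 / p)

/-- A binary vector `b ∈ {0,1}^n`, as a real vector. -/
def binVec {n : ℕ} (b : Fin n → Bool) : Fin n → ℝ := fun i => if b i then 1 else 0

/-- An integer vector `y ∈ ℤ^n`, as a real vector. -/
def intVec {n : ℕ} (y : Fin n → ℤ) : Fin n → ℝ := fun i => (y i : ℝ)

/-- The number of edges cut by the partition described by `b`. -/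
def cut {n m : ℕ} (E : Fin m → Fin n × Fin n) (b : Fin n → Bool) : ℕ :=
  (Finset.univ.filter fun k => b (E k).1 ≠ b (E k).2).card

/-- The edge list covers vertices: every vertex is an endpoint of some edge. -/
def Covers {n m : ℕ} (E : Fin m → Fin n × Fin n) : Prop :=
  ∀ i : Fin n, ∃ k : Fin m, (E k).1 = i ∨ (E k).2 = i

/-- The binarization of an integer vector: `0` if `y i ≤ 0`, `1` if `y i ≥ 1`. -/
def binarize {n : ℕ} (y : Fin n → ℤ) : Fin n → Bool := fun i => decide (1 ≤ y i)

theorem BmatW_mulVec_false {n m : ℕ} (p ι : ℝ) (E : Fin m → Fin n × Fin n) (w : Fin m → ℝ)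
    (v : Fin n → ℝ) (k : Fin m) :
    (BmatW p ι E w).mulVec v (k, false) = v (E k).2 - v (E k).1 := by
  simp [Matrix.mulVec, dotProduct, BmatW, add_mul, Finset.sum_add_distrib, ite_mul]
  ring

theorem BmatW_mulVec_true {n m : ℕ} (p ι : ℝ) (E : Fin m → Fin n × Fin n) (w : Fin m → ℝ)
    (v : Fin n → ℝ) (k : Fin m) :
    (BmatW p ι E w).mulVec v (k, true) = ι * w k ^ (1 / p) * (v (E k).1 + v (E k).2) := by
  simp [Matrix.mulVec, dotProduct, BmatW, add_mul, Finset.sum_add_distrib, ite_mul]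
  ring

theorem lpNorm_le_lpNorm_of_abs_le {d : Type*} [Fintype d] {p : ℝ} (hp : 0 ≤ p) {x y : d → ℝ}
    (h : ∀ j, |x j| ≤ |y j|) : lpNorm p x ≤ lpNorm p y := by
  unfold lpNorm
  refine Real.rpow_le_rpow (by positivity) (Finset.sum_le_sum fun j _ => ?_) (by positivity)
  exact Real.rpow_le_rpow (abs_nonneg _) (h j) hp

theorem binVec_binarize_apply {n : ℕ} (y : Fin n → ℤ) (i : Fin n) :
    binVec (binarize y) i = ((if 1 ≤ y i then 1 else 0 : ℤ) : ℝ) := by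
  simp [binVec, binarize]

theorem abs_binarize_sub_le (a b : ℤ) :
    |(if 1 ≤ b then 1 else 0 : ℤ) - (if 1 ≤ a then 1 else 0)| ≤ |b - a| := by
  grind

theorem abs_binarize_add_sub_one_le (a b : ℤ) :
    |(if 1 ≤ a then 1 else 0 : ℤ) + (if 1 ≤ b then 1 else 0) - 1| ≤ |a + b - 1| := by
  grind

/-- Binarization does not increase any coordinate of the residual in absolute value. -/
theorem abs_residual_binarize_le {n m : ℕ} (p ι : ℝ) (E : Fin m → Fin n × Fin n)
    (w : Fin m → ℝ) (y : Fin n → ℤ) (j : Fin m × Bool) :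
    |((BmatW p ι E w).mulVec (binVec (binarize y)) - tvecW m p ι w) j|
      ≤ |((BmatW p ι E w).mulVec (intVec y) - tvecW m p ι w) j| := by
  obtain ⟨k, _ | _⟩ := j
  · simp only [Pi.sub_apply, BmatW_mulVec_false, binVec_binarize_apply, intVec, tvecW,
      Bool.false_eq_true, if_false, sub_zero]
    exact_mod_cast abs_binarize_sub_le (y (E k).1) (y (E k).2)
  · simp only [Pi.sub_apply, BmatW_mulVec_true, binVec_binarize_apply, intVec, tvecW, if_true,
      ← mul_sub_one, abs_mul]
    refine mul_le_mul_of_nonneg_left ?_ (by positivity)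
    exact_mod_cast abs_binarize_add_sub_one_le (y (E k).1) (y (E k).2)

theorem intVec_boolToInt {n : ℕ} (b : Fin n → Bool) :
    intVec (fun i => if b i then 1 else 0) = binVec b := by
  funext i
  simp [intVec, binVec]

/-- in the weighted reduction, every lattice vector is dominated by a
binary one, and the infimum over `ℤ^n` of the distance equals the minimum over
binary vectors, which is attained. -/
theorem stmt14 (n m : ℕ) (hn : 0 < n) (hm : 0 < m) (p : ℝ) (hp : 1 ≤ p) (ι : ℝ) (hι : 1 < ι)
    (E : Fin m → Fin n × Fin n) (hE : ∀ k, (E k).1 ≠ (E k).2)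
    (w : Fin m → ℝ) (hw : ∀ k, 1 ≤ w k)
    (hcov : Covers E) :
    (∀ y : Fin n → ℤ, ∃ b : Fin n → Bool,
      lpNorm p ((BmatW p ι E w).mulVec (binVec b) - tvecW m p ι w)
        ≤ lpNorm p ((BmatW p ι E w).mulVec (intVec y) - tvecW m p ι w)) ∧
    IsLeast {r : ℝ | ∃ y : Fin n → ℤ,
        r = lpNorm p ((BmatW p ι E w).mulVec (intVec y) - tvecW m p ι w)}
      (Finset.univ.inf' Finset.univ_nonempty fun b : Fin n → Bool =>
        lpNorm p ((BmatW p ι E w).mulVec (binVec b) - tvecW m p ι w)) := by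
  have hdom (y : Fin n → ℤ) :
      lpNorm p ((BmatW p ι E w).mulVec (binVec (binarize y)) - tvecW m p ι w)
        ≤ lpNorm p ((BmatW p ι E w).mulVec (intVec y) - tvecW m p ι w) :=
    lpNorm_le_lpNorm_of_abs_le (by linarith) (abs_residual_binarize_le p ι E w y)
  refine ⟨fun y => ⟨binarize y, hdom y⟩, ?_, ?_⟩
  · obtain ⟨b, -, hb⟩ := Finset.exists_mem_eq_inf' Finset.univ_nonempty fun b : Fin n → Bool =>
      lpNorm p ((BmatW p ι E w).mulVec (binVec b) - tvecW m p ι w)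
    exact ⟨fun i => if b i then 1 else 0, by rw [hb, intVec_boolToInt]⟩
  · rintro _ ⟨y, rfl⟩
    exact (Finset.inf'_le _ (Finset.mem_univ (binarize y))).trans (hdom y)
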